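/- arXiv:0709.1452 — 2 statements merged into one kernel-verified Lean document; each statement's English description precedes it below -/
import Mathlib

section
/- Let (Φ, ω): 𝕍 → 𝕍' be a morphism and ψ' ∈ ∧(V')* a pure spinor defining a Lagrangian subspace F' ⊆ 𝕍'. Then ψ = e^ω ∧ Φ*ψ' is nonzero if and only if the backward image F = F' ∘ Γ_{(Φ,ω)} is a 'transverse composition', i.e. ker(Φ*) ∩ Ann(ran(F')) = {0}; and in that case ψ is a pure spinor defining F. -/
set_option synthInstance.maxHeartbeats 1000000
set_option maxHeartbeats 1000000

open ExteriorAlgebra CliffordAlgebra Module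

/-- Clifford action of `V ⊕ V*` on `∧ V*`. -/
noncomputable def cliffordRho {K V : Type*} [Field K] [AddCommGroup V] [Module K V]
    (w : V × Module.Dual K V) (φ : ExteriorAlgebra K (Module.Dual K V)) :
    ExteriorAlgebra K (Module.Dual K V) :=
  CliffordAlgebra.contractLeft (Module.Dual.eval K V w.1) φ + ExteriorAlgebra.ι K w.2 * φ

/-- Truncated exponential in an algebra, valid for nilpotent arguments of index `≤ n`. -/
noncomputable def expA {K A : Type*} [Field K] [Ring A] [Algebra K A] (n : ℕ) (a : A) : A :=
  ∑ k ∈ Finset.range (n + 1), (k.factorial : K)⁻¹ • a ^ k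

/-- The pullback algebra homomorphism `Φ* : ∧ (V')* → ∧ V*` induced by `Φ : V → V'`. -/
noncomputable def extPullback {K V V' : Type*} [Field K] [AddCommGroup V] [Module K V]
    [AddCommGroup V'] [Module K V'] (Φ : V →ₗ[K] V') :
    ExteriorAlgebra K (Module.Dual K V') →ₐ[K] ExteriorAlgebra K (Module.Dual K V) :=
  ExteriorAlgebra.lift K
    ⟨(ExteriorAlgebra.ι K).comp Φ.dualMap, fun _ => ExteriorAlgebra.ι_sq_zero _⟩

/-- The relation `w ~_{(Φ,ω)} w'` with the 2-form `ω ∈ ∧²V*` an exterior algebra element. -/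
noncomputable def morphRelE {K V V' : Type*} [Field K] [AddCommGroup V] [Module K V]
    [AddCommGroup V'] [Module K V'] (Φ : V →ₗ[K] V')
    (ω : ExteriorAlgebra K (Module.Dual K V))
    (w : V × Module.Dual K V) (w' : V' × Module.Dual K V') : Prop :=
  Φ w.1 = w'.1 ∧
    ExteriorAlgebra.ι K (w'.2.comp Φ) =
      ExteriorAlgebra.ι K w.2 + CliffordAlgebra.contractLeft (Module.Dual.eval K V w.1) ω


section Helpers

variable {K V V' : Type*} [Field K] [AddCommGroup V'] [Module K V'] [AddCommGroup V] [Module K V]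

/-- Contraction by a vector. -/
noncomputable def ct (v : V) :
    ExteriorAlgebra K (Module.Dual K V) →ₗ[K] ExteriorAlgebra K (Module.Dual K V) :=
  CliffordAlgebra.contractLeft (Q := 0) (Module.Dual.eval K V v)

lemma ct_ι_mul (v : V) (a : Module.Dual K V) (b : ExteriorAlgebra K (Module.Dual K V)) :
    ct v (ExteriorAlgebra.ι K a * b) = a v • b - ExteriorAlgebra.ι K a * ct v b :=
  CliffordAlgebra.contractLeft_ι_mul (Q := 0) (d := Module.Dual.eval K V v) a b

lemma ct_alg (v : V) (r : K) :
    ct v (algebraMap K (ExteriorAlgebra K (Module.Dual K V)) r) = 0 :=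
  CliffordAlgebra.contractLeft_algebraMap (Q := 0) (d := Module.Dual.eval K V v) r

lemma ct_ι (v : V) (a : Module.Dual K V) :
    ct v (ExteriorAlgebra.ι K a) = algebraMap K _ (a v) :=
  CliffordAlgebra.contractLeft_ι (Q := 0) (d := Module.Dual.eval K V v) a

lemma ct_comm (v u : V) (b : ExteriorAlgebra K (Module.Dual K V)) :
    ct v (ct u b) = - ct u (ct v b) :=
  CliffordAlgebra.contractLeft_comm (Q := 0) (d := Module.Dual.eval K V v)
    (d' := Module.Dual.eval K V u) b

lemma rho_eq (w : V × Module.Dual K V) (φ : ExteriorAlgebra K (Module.Dual K V)) :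
    cliffordRho w φ = ct w.1 φ + ExteriorAlgebra.ι K w.2 * φ := rfl

lemma ext_ind {P : ExteriorAlgebra K (Module.Dual K V) → Prop}
    (h0 : ∀ r : K, P (algebraMap K _ r))
    (hadd : ∀ x y, P x → P y → P (x + y))
    (hmul : ∀ (x) (m : Module.Dual K V), P x → P (ExteriorAlgebra.ι K m * x)) : ∀ x, P x :=
  CliffordAlgebra.left_induction (Q := 0) h0 hadd hmul

lemma ι_anti {M : Type*} [AddCommGroup M] [Module K M] (a b : M) :
    ExteriorAlgebra.ι K a * ExteriorAlgebra.ι K b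
      = - (ExteriorAlgebra.ι K b * ExteriorAlgebra.ι K a) :=
  eq_neg_of_add_eq_zero_left (ExteriorAlgebra.ι_add_mul_swap a b)

lemma rho_anti (w u : V × Module.Dual K V) (φ : ExteriorAlgebra K (Module.Dual K V)) :
    cliffordRho w (cliffordRho u φ) + cliffordRho u (cliffordRho w φ)
      = (w.2 u.1 + u.2 w.1) • φ := by
  simp only [rho_eq, map_add, ct_ι_mul, mul_add]
  rw [ct_comm w.1 u.1, ← mul_assoc, ← mul_assoc, ι_anti w.2 u.2, neg_mul, add_smul]
  abel

lemma rho_isotropic {w u : V × Module.Dual K V} {φ : ExteriorAlgebra K (Module.Dual K V)}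
    (hφ : φ ≠ 0) (hw : cliffordRho w φ = 0) (hu : cliffordRho u φ = 0) :
    w.2 u.1 + u.2 w.1 = 0 := by
  have h := rho_anti w u φ
  rw [hw, hu] at h
  simp only [rho_eq, map_zero, mul_zero, add_zero] at h
  exact (smul_eq_zero.1 h.symm).resolve_right hφ

lemma pull_ι (Φ : V →ₗ[K] V') (a : Module.Dual K V') :
    extPullback Φ (ExteriorAlgebra.ι K a) = ExteriorAlgebra.ι K (a.comp Φ) := by
  simp only [extPullback, ExteriorAlgebra.lift_ι_apply]
  rfl

lemma pull_ct (Φ : V →ₗ[K] V') (v : V) (φ : ExteriorAlgebra K (Module.Dual K V')) :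
    ct v (extPullback Φ φ) = extPullback Φ (ct (Φ v) φ) := by
  induction φ using ext_ind with
  | h0 r => rw [AlgHom.commutes, ct_alg, ct_alg, map_zero]
  | hadd x y hx hy => simp only [map_add, hx, hy]
  | hmul x m hx =>
    rw [map_mul, pull_ι, ct_ι_mul, hx, ct_ι_mul, map_sub, map_smul, map_mul, pull_ι]
    rfl

lemma pull_rank_one (p : V →ₗ[K] V') (γ : Module.Dual K V) (c : V')
    (φ : ExteriorAlgebra K (Module.Dual K V')) :
    extPullback (p + γ.smulRight c) φ
      = extPullback p φ + ExteriorAlgebra.ι K γ * extPullback p (ct c φ) := by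
  induction φ using ext_ind with
  | h0 r => rw [AlgHom.commutes, AlgHom.commutes, ct_alg, map_zero, mul_zero, add_zero]
  | hadd x y hx hy => simp only [map_add, hx, hy, mul_add]; abel
  | hmul x m hx =>
    have e : m.comp (p + γ.smulRight c) = m.comp p + m c • γ := by
      ext v; simp [mul_comm]
    have h0 : ExteriorAlgebra.ι K γ * (ExteriorAlgebra.ι K γ * extPullback p (ct c x)) = 0 := by
      rw [← mul_assoc, ExteriorAlgebra.ι_sq_zero, zero_mul]
    have h1 : ExteriorAlgebra.ι K (m.comp p) * (ExteriorAlgebra.ι K γ * extPullback p (ct c x))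
        = - (ExteriorAlgebra.ι K γ * (ExteriorAlgebra.ι K (m.comp p) * extPullback p (ct c x))) := by
      rw [← mul_assoc, ι_anti, neg_mul, mul_assoc]
    rw [map_mul, map_mul, pull_ι, pull_ι, hx, e, ct_ι_mul, map_add, map_smul, map_sub, map_smul,
      map_mul, pull_ι, add_mul, mul_add, mul_add, smul_mul_assoc, smul_mul_assoc, h0, h1, mul_sub,
      mul_smul_comm, smul_zero, add_zero]
    abel

lemma pull_id (φ : ExteriorAlgebra K (Module.Dual K V)) :
    extPullback (LinearMap.id : V →ₗ[K] V) φ = φ := by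
  induction φ using ext_ind with
  | h0 r => rw [AlgHom.commutes]
  | hadd x y hx hy => simp only [map_add, hx, hy]
  | hmul x m hx => rw [map_mul, hx, pull_ι]; rfl

lemma pull_comp_zero (Φ : V →ₗ[K] V') (s : V' →ₗ[K] V) (φ : ExteriorAlgebra K (Module.Dual K V')) :
    extPullback (Φ.comp s) φ = extPullback s (extPullback Φ φ) := by
  induction φ using ext_ind with
  | h0 r => simp only [AlgHom.commutes]
  | hadd x y hx hy => simp only [map_add, hx, hy]
  | hmul x m hx => rw [map_mul, hx, pull_ι, map_mul, map_mul, pull_ι, pull_ι]; rfl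

/-- Adding finitely many rank one terms with values in `ran F'`. -/
lemma pull_sum_zero {ι' : Type*} (p : V →ₗ[K] V') (ψ' : ExteriorAlgebra K (Module.Dual K V'))
    (γ : ι' → Module.Dual K V) (c : ι' → V')
    (hc : ∀ j, ∃ μ : Module.Dual K V', cliffordRho (c j, μ) ψ' = 0)
    (hp : extPullback p ψ' = 0) (S : Finset ι') :
    extPullback (p + ∑ j ∈ S, (γ j).smulRight (c j)) ψ' = 0 := by
  classical
  induction S using Finset.induction_on with
  | empty => simpa using hp
  | insert j S hj ih =>
    rw [Finset.sum_insert hj, add_comm ((γ j).smulRight (c j)), ← add_assoc, pull_rank_one, ih]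
    obtain ⟨μ, hμ⟩ := hc j
    rw [rho_eq] at hμ
    rw [eq_neg_of_add_eq_zero_left hμ, map_neg, map_mul, ih]
    simp

/-- `cliffordRho` as a linear map in the vector. -/
noncomputable def rhoLin (φ : ExteriorAlgebra K (Module.Dual K V)) :
    (V × Module.Dual K V) →ₗ[K] ExteriorAlgebra K (Module.Dual K V) where
  toFun w := cliffordRho w φ
  map_add' x y := by
    simp only [cliffordRho, Prod.fst_add, Prod.snd_add, map_add, LinearMap.add_apply, add_mul]
    abel
  map_smul' r x := by
    simp only [cliffordRho, Prod.smul_fst, Prod.smul_snd, map_smul, LinearMap.smul_apply,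
      smul_mul_assoc, smul_add, RingHom.id_apply]

/-- A 2-form acts as an even element. -/
lemma two_form (ω : ExteriorAlgebra K (Module.Dual K V)) (hω : ω ∈ (⋀[K]^2 (Module.Dual K V))) :
    (∀ m : Module.Dual K V, ω * ExteriorAlgebra.ι K m = ExteriorAlgebra.ι K m * ω) ∧
    (∀ v : V, ∃ η : Module.Dual K V, ct v ω = ExteriorAlgebra.ι K η ∧
      ∀ φ, ct v (ω * φ) = ExteriorAlgebra.ι K η * φ + ω * ct v φ) := by
  rw [exteriorPower, pow_two] at hω
  induction hω using Submodule.mul_induction_on' with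
  | mem_mul_mem x hx y hy =>
    obtain ⟨a, rfl⟩ := hx
    obtain ⟨b, rfl⟩ := hy
    refine ⟨fun m => ?_, fun v => ⟨a v • b - b v • a, ?_, fun φ => ?_⟩⟩
    · rw [mul_assoc, ι_anti b m, mul_neg, ← mul_assoc, ι_anti a m, neg_mul, neg_neg, mul_assoc]
    · rw [ct_ι_mul, ct_ι, map_sub, map_smul, map_smul, ← Algebra.commutes, Algebra.smul_def (b v)]
    · rw [mul_assoc, ct_ι_mul, ct_ι_mul, map_sub, map_smul, map_smul, mul_sub, sub_mul,
        mul_smul_comm, smul_mul_assoc, smul_mul_assoc, mul_assoc]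
      abel
  | add x hx y hy h1 h2 =>
    refine ⟨fun m => by rw [add_mul, mul_add, h1.1, h2.1], fun v => ?_⟩
    obtain ⟨η1, a1, b1⟩ := h1.2 v
    obtain ⟨η2, a2, b2⟩ := h2.2 v
    refine ⟨η1 + η2, by rw [map_add, map_add, a1, a2], fun φ => ?_⟩
    rw [add_mul, map_add, b1, b2, map_add, add_mul, add_mul]
    abel

lemma ct_pow (ω : ExteriorAlgebra K (Module.Dual K V)) (v : V) (η : Module.Dual K V)
    (hc : ω * ExteriorAlgebra.ι K η = ExteriorAlgebra.ι K η * ω)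
    (h : ∀ φ, ct v (ω * φ) = ExteriorAlgebra.ι K η * φ + ω * ct v φ) (k : ℕ) :
    ∀ φ, ct v (ω ^ (k + 1) * φ)
      = ((k + 1 : ℕ) : K) • (ExteriorAlgebra.ι K η * (ω ^ k * φ)) + ω ^ (k + 1) * ct v φ := by
  induction k with
  | zero => intro φ; simp [h]
  | succ k ih =>
    intro φ
    rw [pow_succ' ω (k + 1), mul_assoc, h, ih, mul_add, mul_smul_comm, ← mul_assoc ω, hc,
      mul_assoc _ ω, ← mul_assoc ω, ← pow_succ', ← mul_assoc ω, Nat.cast_succ (k + 1), add_smul,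
      one_smul]
    abel

lemma expA_succ (n : ℕ) {A : Type*} [Ring A] [Algebra K A] (a : A) :
    expA (K := K) (n + 1) a = expA (K := K) n a + ((n + 1).factorial : K)⁻¹ • a ^ (n + 1) := by
  rw [expA, Finset.sum_range_succ]; rfl

lemma ct_exp [CharZero K] (ω : ExteriorAlgebra K (Module.Dual K V)) (v : V) (η : Module.Dual K V)
    (hc : ω * ExteriorAlgebra.ι K η = ExteriorAlgebra.ι K η * ω)
    (h : ∀ φ, ct v (ω * φ) = ExteriorAlgebra.ι K η * φ + ω * ct v φ) (n : ℕ) (φ) :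
    ct v (expA (K := K) (n + 1) ω * φ)
      = ExteriorAlgebra.ι K η * (expA (K := K) n ω * φ) + expA (K := K) (n + 1) ω * ct v φ := by
  induction n with
  | zero => simp [expA, Finset.sum_range_succ, add_mul, h]; abel
  | succ n ih =>
    rw [expA_succ (n + 1), add_mul, map_add, ih, smul_mul_assoc, map_smul, ct_pow ω v η hc h,
      expA_succ n, smul_add, smul_smul]
    have : ((n + 1 + 1).factorial : K)⁻¹ * ((n + 1 + 1 : ℕ) : K) = ((n + 1).factorial : K)⁻¹ := by
      rw [Nat.factorial_succ (n + 1), Nat.cast_mul, mul_inv, mul_right_comm,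
        inv_mul_cancel₀ (Nat.cast_ne_zero.2 (Nat.succ_ne_zero _)), one_mul]
    rw [this]
    simp only [add_mul, mul_add, smul_mul_assoc, mul_smul_comm]
    abel

lemma form_nil [FiniteDimensional K V] (ω : ExteriorAlgebra K (Module.Dual K V))
    (hω : ω ∈ (⋀[K]^2 (Module.Dual K V))) : ω ^ (Module.finrank K V + 1) = 0 := by
  have h1 : ω ^ (Module.finrank K V + 1) ∈ (⋀[K]^(2 * (Module.finrank K V + 1)) (Module.Dual K V)) := by
    rw [exteriorPower, pow_mul]
    exact Submodule.pow_mem_pow _ hω _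
  have h2 := exteriorPower.finrank_eq K (2 * (Module.finrank K V + 1)) (M := Module.Dual K V)
  rw [Subspace.dual_finrank_eq, Nat.choose_eq_zero_of_lt (by omega)] at h2
  have : (⋀[K]^(2 * (Module.finrank K V + 1)) (Module.Dual K V)) = ⊥ :=
    Submodule.finrank_eq_zero.1 h2
  rw [this] at h1
  exact h1

lemma expA_unit {A : Type*} [Ring A] [Algebra K A] (n N : ℕ) (a : A) (ha : a ^ N = 0) :
    IsUnit (expA (K := K) n a) := by
  have : ∀ n, ∃ b : A, Commute a b ∧ expA (K := K) n a = 1 + a * b := by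
    intro n
    induction n with
    | zero => exact ⟨0, Commute.zero_right _, by simp [expA]⟩
    | succ n ih =>
      obtain ⟨b, h1, h2⟩ := ih
      refine ⟨b + ((n + 1).factorial : K)⁻¹ • a ^ n,
        h1.add_right ((Commute.self_pow a n).smul_right _), ?_⟩
      rw [expA_succ, h2, mul_add, mul_smul_comm, ← pow_succ', add_assoc]
  obtain ⟨b, h1, h2⟩ := this n
  rw [h2]
  exact IsNilpotent.isUnit_one_add ⟨N, by rw [h1.mul_pow, ha, zero_mul]⟩

/-- The intertwining property of `e^ω`. -/
lemma rho_exp [CharZero K] [FiniteDimensional K V] (ω : ExteriorAlgebra K (Module.Dual K V))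
    (hω : ω ∈ (⋀[K]^2 (Module.Dual K V))) (w : V × Module.Dual K V) :
    ∃ η : Module.Dual K V, ct w.1 ω = ExteriorAlgebra.ι K η ∧ ∀ φ,
      cliffordRho w (expA (K := K) (Module.finrank K V) ω * φ)
        = expA (K := K) (Module.finrank K V) ω * cliffordRho (w.1, w.2 + η) φ := by
  obtain ⟨hc, h⟩ := two_form ω hω
  obtain ⟨η, h1, h2⟩ := h w.1
  refine ⟨η, h1, fun φ => ?_⟩
  have h3 := ct_exp ω w.1 η (hc η) h2 (Module.finrank K V) φ
  rw [expA_succ, form_nil ω hω, smul_zero, add_zero] at h3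
  have h4 : ∀ m, expA (K := K) (Module.finrank K V) ω * ExteriorAlgebra.ι K m
      = ExteriorAlgebra.ι K m * expA (K := K) (Module.finrank K V) ω := by
    intro m
    unfold expA
    exact Commute.sum_left _ _ _ fun i _ => (Commute.pow_left (hc m) i).smul_left _
  rw [rho_eq, rho_eq, h3, mul_add, ← mul_assoc _ (ExteriorAlgebra.ι K (w.2 + η)), h4, map_add,
    add_mul, add_mul, mul_assoc, mul_assoc]
  abel

lemma exists_factor {A B : Type*} [AddCommGroup A] [Module K A] [AddCommGroup B] [Module K B]
    (q : A →ₗ[K] B) (f : Module.Dual K A) (h : ∀ x, q x = 0 → f x = 0) :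
    ∃ g : Module.Dual K B, ∀ x, g (q x) = f x := by
  have : f ∈ LinearMap.range q.dualMap := by
    rw [LinearMap.range_dualMap_eq_dualAnnihilator_ker, Submodule.mem_dualAnnihilator]
    exact fun x hx => h x hx
  obtain ⟨g, hg⟩ := this
  exact ⟨g, fun x => LinearMap.congr_fun hg x⟩

end Helpers

/-- let `(Φ, ω)` be a morphism and `ψ'` a pure spinor defining a Lagrangian
subspace `F' ⊆ 𝕍'`. Then `ψ = e^ω ∧ Φ*ψ'` is nonzero iff
`ker(Φ*) ∩ Ann(ran F') = {0}`, and in that case `ψ` is a pure spinor defining the backward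
image `F = F' ∘ Γ_{(Φ,ω)}`. -/
theorem pure_spinors_stmt10 {K V V' : Type*} [Field K] [CharZero K]
    [AddCommGroup V] [Module K V] [FiniteDimensional K V]
    [AddCommGroup V'] [Module K V'] [FiniteDimensional K V']
    (Φ : V →ₗ[K] V')
    (ω : ExteriorAlgebra K (Module.Dual K V)) (hω : ω ∈ (⋀[K]^2 (Module.Dual K V)))
    (ψ' : ExteriorAlgebra K (Module.Dual K V')) (hψ' : ψ' ≠ 0)
    (F' : Set (V' × Module.Dual K V'))
    (hF'ψ : F' = {w' | cliffordRho w' ψ' = 0})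
    (hF'lag : ∀ w', w' ∈ F' ↔ ∀ u' ∈ F', w'.2 u'.1 + u'.2 w'.1 = 0)
    (ψ : ExteriorAlgebra K (Module.Dual K V))
    (hψ : ψ = expA (K := K) (Module.finrank K V) ω * extPullback Φ ψ') :
    (ψ ≠ 0 ↔
      ∀ β : Module.Dual K V', Φ.dualMap β = 0 → (∀ w' ∈ F', β w'.1 = 0) → β = 0) ∧
    (ψ ≠ 0 →
      ∀ w : V × Module.Dual K V, cliffordRho w ψ = 0 ↔ ∃ w' ∈ F', morphRelE Φ ω w w') := by
  have hnil := form_nil ω hω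
  have hunit := expA_unit (K := K) (Module.finrank K V) _ ω hnil
  have hF : ∀ w', w' ∈ F' ↔ cliffordRho w' ψ' = 0 := by intro w'; rw [hF'ψ]; rfl
  have hz : ∀ x, expA (K := K) (Module.finrank K V) ω * x = 0 ↔ x = 0 := fun x =>
    hunit.mul_right_eq_zero
  have hne : ψ ≠ 0 ↔ extPullback Φ ψ' ≠ 0 := by rw [hψ, Ne, hz]
  refine ⟨⟨fun h β hβ hβF => ?_, fun h => ?_⟩, fun h w => ⟨fun hw => ?_, ?_⟩⟩
  · by_contra hβ0
    apply hne.1 h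
    have hm : ((0 : V'), β) ∈ F' := (hF'lag _).2 fun u hu => by simp [hβF u hu]
    rw [hF, rho_eq] at hm
    have hm' : ExteriorAlgebra.ι K β * ψ' = 0 := by
      have h0 : ct (K := K) (0 : V') = 0 := by simp [ct]
      simpa [h0] using hm
    obtain ⟨x, hx⟩ : ∃ x, β x ≠ 0 := by
      by_contra hcon
      push Not at hcon
      exact hβ0 (LinearMap.ext hcon)
    have h2 := ct_ι_mul x β ψ'
    rw [hm', map_zero] at h2
    have h3 := congrArg (extPullback Φ) (sub_eq_zero.1 h2.symm)
    have h4 : β.comp Φ = 0 := hβ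
    rw [map_smul, map_mul, pull_ι, h4, map_zero, zero_mul] at h3
    exact (smul_eq_zero.1 h3).resolve_left hx
  · rw [hne]
    intro h0
    set R : Submodule K V' := (LinearMap.ker (rhoLin ψ')).map (LinearMap.fst K _ _) with hR
    have hRm : ∀ r : R, ∃ μ : Module.Dual K V', cliffordRho ((r : V'), μ) ψ' = 0 := by
      rintro ⟨r, ⟨a, b⟩, hab, rfl⟩
      exact ⟨b, hab⟩
    have htop : LinearMap.range (Φ.coprod R.subtype) = ⊤ := by
      rw [← Submodule.dualAnnihilator_eq_bot_iff, eq_bot_iff]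
      intro β hβ
      rw [Submodule.mem_dualAnnihilator] at hβ
      refine h β ?_ fun w' hw' => ?_
      · ext v
        simpa using hβ (Φ v) ⟨(v, 0), by simp⟩
      · exact hβ w'.1 ⟨(0, ⟨w'.1, w', (hF w').1 hw', rfl⟩), by simp⟩
    obtain ⟨σ, hσ⟩ := LinearMap.exists_rightInverse_of_surjective _ htop
    let b := Module.finBasis K V'
    have key := pull_sum_zero (Φ.comp ((LinearMap.fst K _ _).comp σ)) ψ' (fun j => b.coord j)
      (fun j => ((σ (b j)).2 : V')) (fun j => hRm _)
      (by rw [pull_comp_zero, h0, map_zero]) Finset.univ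
    have hid : Φ.comp ((LinearMap.fst K _ _).comp σ)
        + ∑ j ∈ Finset.univ, (b.coord j).smulRight ((σ (b j)).2 : V') = LinearMap.id := by
      refine b.ext fun i => ?_
      have := LinearMap.congr_fun hσ (b i)
      simpa [Finsupp.single_apply, LinearMap.sum_apply, LinearMap.coprod_apply] using this
    rw [hid, pull_id] at key
    exact hψ' key
  · have hne' := hne.1 h
    obtain ⟨η, hη, hexp⟩ := rho_exp ω hω w
    rw [hψ, hexp, hz] at hw
    have hpull : ∀ (x : V) (μ : Module.Dual K V'),
        cliffordRho (x, μ.comp Φ) (extPullback Φ ψ') = extPullback Φ (cliffordRho (Φ x, μ) ψ') := by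
      intro x μ
      rw [rho_eq, rho_eq, map_add, map_mul, pull_ct, pull_ι]
    have hiso : ∀ (x : V) (μ : Module.Dual K V'), (Φ x, μ) ∈ F' →
        (w.2 + η) x + μ (Φ w.1) = 0 := by
      intro x μ hx
      refine rho_isotropic (u := (x, μ.comp Φ)) hne' hw ?_
      rw [hpull, (hF _).1 hx, map_zero]
    have h0F : ((0 : V'), (0 : Module.Dual K V')) ∈ F' := by
      rw [hF]; exact (rhoLin ψ').map_zero
    obtain ⟨α, hα⟩ : ∃ α : Module.Dual K V', Φ.dualMap α = w.2 + η := by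
      have : w.2 + η ∈ LinearMap.range Φ.dualMap := by
        rw [LinearMap.range_dualMap_eq_dualAnnihilator_ker, Submodule.mem_dualAnnihilator]
        intro x hx
        have hx' : Φ x = 0 := hx
        simpa using hiso x 0 (by rw [hx']; exact h0F)
      exact this
    have hα' : ∀ x, α (Φ x) = (w.2 + η) x := fun x => LinearMap.congr_fun hα x
    let P : Submodule K (V' × Module.Dual K V') := LinearMap.ker (rhoLin ψ')
    have hP : ∀ p, p ∈ P ↔ p ∈ F' := fun p => (hF p).symm
    let f : Module.Dual K P :=
      -((α.comp (LinearMap.fst K _ _) + (Module.Dual.eval K V' (Φ w.1)).comp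
        (LinearMap.snd K V' (Module.Dual K V'))).comp P.subtype)
    have hf : ∀ p : P, f p = -(α p.1.1 + p.1.2 (Φ w.1)) := fun p => rfl
    let q : P →ₗ[K] (V' ⧸ LinearMap.range Φ) :=
      (LinearMap.range Φ).mkQ.comp ((LinearMap.fst K _ _).comp P.subtype)
    obtain ⟨g, hg⟩ : ∃ g : Module.Dual K (V' ⧸ LinearMap.range Φ), ∀ x, g (q x) = f x := by
      refine exists_factor (K := K) (A := P) (B := V' ⧸ LinearMap.range Φ) q f ?_
      rintro ⟨⟨u, μ⟩, hp⟩ hx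
      have hx' : u ∈ LinearMap.range Φ := (Submodule.Quotient.mk_eq_zero _).1 hx
      obtain ⟨x, rfl⟩ := hx'
      rw [hf]
      simp only
      rw [hα', hiso x μ ((hP _).1 hp), neg_zero]
    let γ : Module.Dual K V' := g.comp (LinearMap.range Φ).mkQ
    have hγΦ : ∀ x, γ (Φ x) = 0 := by
      intro x
      have : (LinearMap.range Φ).mkQ (Φ x) = 0 := (Submodule.Quotient.mk_eq_zero _).2 ⟨x, rfl⟩
      change g ((LinearMap.range Φ).mkQ (Φ x)) = 0
      rw [this, map_zero]
    refine ⟨(Φ w.1, α + γ), (hF'lag _).2 fun u hu => ?_, rfl, ?_⟩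
    · have h1 : γ u.1 = f ⟨u, (hP u).2 hu⟩ := by rw [← hg]; rfl
      rw [hf] at h1
      simp only [LinearMap.add_apply, h1]
      ring
    · have h1 : (α + γ).comp Φ = w.2 + η := by
        ext x
        change α (Φ x) + γ (Φ x) = (w.2 + η) x
        rw [hγΦ x, hα' x, add_zero]
      change ExteriorAlgebra.ι K ((α + γ).comp Φ) = ExteriorAlgebra.ι K w.2 + ct w.1 ω
      rw [h1, hη, map_add]
  · rintro ⟨w', hw', h1, h2⟩
    obtain ⟨η, hη, hexp⟩ := rho_exp ω hω w
    change ExteriorAlgebra.ι K (w'.2.comp Φ) = ExteriorAlgebra.ι K w.2 + ct w.1 ω at h2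
    rw [hη, ← map_add] at h2
    rw [hψ, hexp, hz, rho_eq]
    simp only
    rw [← h2, pull_ct, h1, ← pull_ι, ← map_mul, ← map_add, ← rho_eq, (hF _).1 hw', map_zero]
end

section
/- Let E, F be transverse Lagrangian subspaces of 𝕍 = V ⊕ V*, defined by pure spinors φ, ψ ∈ ∧V*. Then for any two pure spinors φ, ψ defining transverse Lagrangian subspaces, the top-degree component of φᵀ ∧ ψ is nonzero (Cartan/Chevalley); conversely, if E and F are not transverse then (φᵀ ∧ ψ)^[top] = 0. -/
set_option synthInstance.maxHeartbeats 1000000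
set_option maxHeartbeats 1000000

open ExteriorAlgebra CliffordAlgebra Module

/-- The reversal anti-automorphism `ᵀ` of `∧ V*`. -/
noncomputable def revE {K V : Type*} [Field K] [AddCommGroup V] [Module K V]
    (x : ExteriorAlgebra K (Module.Dual K V)) : ExteriorAlgebra K (Module.Dual K V) :=
  CliffordAlgebra.reverse (Q := (0 : QuadraticForm K (Module.Dual K V))) x

namespace PureSpinorAux

variable {K V : Type*} [Field K] [AddCommGroup V] [Module K V]

/-- Contraction by a vector. -/
noncomputable abbrev ctr (v : V) :
    ExteriorAlgebra K (Module.Dual K V) →ₗ[K] ExteriorAlgebra K (Module.Dual K V) :=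
  CliffordAlgebra.contractLeft (Module.Dual.eval K V v)

/-- Degree projection. -/
noncomputable abbrev pr (i : ℕ) :
    ExteriorAlgebra K (Module.Dual K V) →ₗ[K] ExteriorAlgebra K (Module.Dual K V) :=
  GradedAlgebra.proj (fun i : ℕ => ⋀[K]^i (Module.Dual K V)) i

lemma ctr_ι_mul (v : V) (a : Module.Dual K V) (x : ExteriorAlgebra K (Module.Dual K V)) :
    ctr v (ExteriorAlgebra.ι K a * x) = a v • x - ExteriorAlgebra.ι K a * ctr v x :=
  CliffordAlgebra.contractLeft_ι_mul _ _ _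

lemma ctr_algebraMap (v : V) (r : K) :
    ctr v (algebraMap K (ExteriorAlgebra K (Module.Dual K V)) r) = 0 :=
  CliffordAlgebra.contractLeft_algebraMap _ _ _

/-- The Clifford action as a bilinear map. -/
noncomputable def rho : (V × Module.Dual K V) →ₗ[K]
    ExteriorAlgebra K (Module.Dual K V) →ₗ[K] ExteriorAlgebra K (Module.Dual K V) :=
  (CliffordAlgebra.contractLeft.comp (Module.Dual.eval K V)).comp (LinearMap.fst K _ _) +
    ((LinearMap.mul K (ExteriorAlgebra K (Module.Dual K V))).comp (ExteriorAlgebra.ι K)).comp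
      (LinearMap.snd K _ _)

lemma rho_apply (w : V × Module.Dual K V) (x : ExteriorAlgebra K (Module.Dual K V)) :
    rho w x = ctr w.1 x + ExteriorAlgebra.ι K w.2 * x := rfl

lemma rho_eq (w : V × Module.Dual K V) (x : ExteriorAlgebra K (Module.Dual K V)) :
    cliffordRho w x = rho w x := rfl

lemma ι_mul_ι_mul (a b : Module.Dual K V) (x : ExteriorAlgebra K (Module.Dual K V)) :
    ExteriorAlgebra.ι K a * (ExteriorAlgebra.ι K b * x) +
      ExteriorAlgebra.ι K b * (ExteriorAlgebra.ι K a * x) = 0 := by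
  rw [← mul_assoc, ← mul_assoc, ← add_mul, ExteriorAlgebra.ι_add_mul_swap, zero_mul]

lemma rho_anticomm (w u : V × Module.Dual K V) (x : ExteriorAlgebra K (Module.Dual K V)) :
    rho w (rho u x) + rho u (rho w x) = (w.2 u.1 + u.2 w.1) • x := by
  have h1 : ctr w.1 (ctr u.1 x) = - ctr u.1 (ctr w.1 x) :=
    CliffordAlgebra.contractLeft_comm _ _ _
  have h2 := ι_mul_ι_mul w.2 u.2 x
  simp only [rho_apply, map_add, ctr_ι_mul, mul_add, h1, add_smul]
  rw [← sub_eq_zero]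
  rw [← h2]
  abel

lemma mem_induction (P : ExteriorAlgebra K (Module.Dual K V) → Prop)
    (hadd : ∀ x y, P x → P y → P (x + y))
    (hhom : ∀ k, ∀ x ∈ ⋀[K]^k (Module.Dual K V), P x) (x) : P x := by
  induction x using DirectSum.Decomposition.inductionOn
    (fun i : ℕ => ⋀[K]^i (Module.Dual K V)) with
  | zero => exact hhom 0 0 (zero_mem _)
  | homogeneous m => exact hhom _ _ m.2
  | add x y hx hy => exact hadd x y hx hy

lemma ι_mul_mem {a : Module.Dual K V} {k : ℕ} {x : ExteriorAlgebra K (Module.Dual K V)}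
    (hx : x ∈ ⋀[K]^k (Module.Dual K V)) :
    ExteriorAlgebra.ι K a * x ∈ ⋀[K]^(k + 1) (Module.Dual K V) := by
  unfold exteriorPower at *
  rw [pow_succ']
  exact Submodule.mul_mem_mul ⟨a, rfl⟩ hx

lemma ctr_mem (v : V) {k : ℕ} {x : ExteriorAlgebra K (Module.Dual K V)}
    (hx : x ∈ ⋀[K]^k (Module.Dual K V)) :
    (k = 0 → ctr v x = 0) ∧ ∀ j, k = j + 1 → ctr v x ∈ ⋀[K]^j (Module.Dual K V) := by
  induction hx using Submodule.pow_induction_on_left' with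
  | algebraMap r => exact ⟨fun _ => ctr_algebraMap v r, fun j hj => by omega⟩
  | add x y i hx hy h1 h2 =>
    refine ⟨fun h => ?_, fun j hj => ?_⟩
    · rw [map_add, h1.1 h, h2.1 h, add_zero]
    · rw [map_add]; exact add_mem (h1.2 j hj) (h2.2 j hj)
  | mem_mul m hm i x hx ih =>
    obtain ⟨a, rfl⟩ := hm
    refine ⟨fun h => by omega, fun j hj => ?_⟩
    obtain rfl : i = j := by omega
    have := ctr_ι_mul v a x
    rw [this]
    refine sub_mem (Submodule.smul_mem _ _ hx) ?_
    cases i with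
    | zero => rw [ih.1 rfl, mul_zero]; exact zero_mem _
    | succ i => exact ι_mul_mem (ih.2 i rfl)

lemma pr_of_mem {k : ℕ} {x : ExteriorAlgebra K (Module.Dual K V)}
    (hx : x ∈ ⋀[K]^k (Module.Dual K V)) (i : ℕ) : pr i x = if i = k then x else 0 := by
  split_ifs with h
  · subst h
    exact DirectSum.decompose_of_mem_same (fun i : ℕ => ⋀[K]^i (Module.Dual K V)) hx
  · exact DirectSum.decompose_of_mem_ne (fun i : ℕ => ⋀[K]^i (Module.Dual K V)) hx (Ne.symm h)

lemma pr_mem (i : ℕ) (x : ExteriorAlgebra K (Module.Dual K V)) :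
    pr i x ∈ ⋀[K]^i (Module.Dual K V) :=
  (DirectSum.decompose (fun i : ℕ => ⋀[K]^i (Module.Dual K V)) x i).2

lemma eq_of_pr (x y : ExteriorAlgebra K (Module.Dual K V)) (h : ∀ i, pr i x = pr i y) :
    x = y := by
  apply (DirectSum.decompose (fun i : ℕ => ⋀[K]^i (Module.Dual K V))).injective
  apply DFinsupp.ext
  intro i
  exact Subtype.ext (h i)

lemma pr_ctr (v : V) (i : ℕ) (x : ExteriorAlgebra K (Module.Dual K V)) :
    pr i (ctr v x) = ctr v (pr (i + 1) x) := by
  induction x using mem_induction with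
  | hadd x y hx hy => rw [map_add, map_add, map_add, map_add, hx, hy]
  | hhom k x hx =>
    rw [pr_of_mem hx]
    cases k with
    | zero => rw [(ctr_mem v hx).1 rfl]; simp
    | succ k =>
      rw [pr_of_mem ((ctr_mem v hx).2 k rfl)]
      by_cases h : i = k <;> simp [h]

section fin
variable [FiniteDimensional K V]

lemma eq_zero_of_lt {k : ℕ} (hk : finrank K V < k) {x : ExteriorAlgebra K (Module.Dual K V)}
    (hx : x ∈ ⋀[K]^k (Module.Dual K V)) : x = 0 := by
  have h : Module.finrank K (⋀[K]^k (Module.Dual K V)) = 0 := by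
    rw [exteriorPower.finrank_eq, Subspace.dual_finrank_eq, Nat.choose_eq_zero_of_lt hk]
  rw [Submodule.finrank_eq_zero] at h
  rw [h] at hx
  simpa using hx

lemma exists_top : ∃ x : ExteriorAlgebra K (Module.Dual K V), pr (finrank K V) x ≠ 0 := by
  have h : Module.finrank K (⋀[K]^(finrank K V) (Module.Dual K V)) = 1 := by
    rw [exteriorPower.finrank_eq, Subspace.dual_finrank_eq, Nat.choose_self]
  have h2 : ⋀[K]^(finrank K V) (Module.Dual K V) ≠ ⊥ := by
    intro h3
    rw [h3] at h
    simp at h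
  obtain ⟨x, hx, hx0⟩ := Submodule.exists_mem_ne_zero_of_ne_bot h2
  refine ⟨x, ?_⟩
  rw [pr_of_mem hx]
  simpa using hx0

/-- top degree of a contraction vanishes -/
lemma top_ctr (v : V) (x : ExteriorAlgebra K (Module.Dual K V)) :
    pr (finrank K V) (ctr v x) = 0 := by
  rw [pr_ctr, eq_zero_of_lt (Nat.lt_succ_self _) (pr_mem _ x), map_zero]

/-- The spinor pairing. -/
noncomputable def pairing : ExteriorAlgebra K (Module.Dual K V) →ₗ[K]
    ExteriorAlgebra K (Module.Dual K V) →ₗ[K] ExteriorAlgebra K (Module.Dual K V) :=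
  ((LinearMap.mul K (ExteriorAlgebra K (Module.Dual K V))).compr₂ (pr (finrank K V))).comp
    (CliffordAlgebra.reverse (Q := (0 : QuadraticForm K (Module.Dual K V))))

lemma pairing_apply (x y : ExteriorAlgebra K (Module.Dual K V)) :
    pairing x y = pr (finrank K V) (revE x * y) := rfl

lemma revE_ι_mul (a : Module.Dual K V) (x : ExteriorAlgebra K (Module.Dual K V)) :
    revE (ExteriorAlgebra.ι K a * x) = revE x * ExteriorAlgebra.ι K a := by
  have h : revE (ExteriorAlgebra.ι K a) = ExteriorAlgebra.ι K a := CliffordAlgebra.reverse_ι _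
  exact (CliffordAlgebra.reverse.map_mul _ _).trans (congrArg _ h)

lemma revE_algebraMap (r : K) :
    revE (algebraMap K (ExteriorAlgebra K (Module.Dual K V)) r) = algebraMap K _ r :=
  CliffordAlgebra.reverse.commutes _

lemma pairing_ι_mul (a : Module.Dual K V) (x y : ExteriorAlgebra K (Module.Dual K V)) :
    pairing (ExteriorAlgebra.ι K a * x) y = pairing x (ExteriorAlgebra.ι K a * y) := by
  rw [pairing_apply, pairing_apply, revE_ι_mul, mul_assoc]

lemma pairing_ctr (v : V) (x y : ExteriorAlgebra K (Module.Dual K V)) :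
    pairing (ctr v x) y = pairing x (ctr v y) := by
  induction x using CliffordAlgebra.left_induction generalizing y with
  | algebraMap r =>
    have h := ctr_algebraMap (V := V) v r
    rw [h, map_zero, LinearMap.zero_apply, pairing_apply]
    have h := revE_algebraMap (V := V) r
    rw [h, ← Algebra.smul_def, map_smul, top_ctr, smul_zero]
  | add x x' hx hy => rw [map_add, map_add, map_add, LinearMap.add_apply, LinearMap.add_apply, hx, hy]
  | ι_mul x a hx =>
    have h := ctr_ι_mul v a x
    have h2 := pairing_ι_mul a x
    refine (congrArg (fun z => pairing z y) h).trans (Eq.trans ?_ (h2 _).symm)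
    simp only [map_sub, map_smul, LinearMap.sub_apply, LinearMap.smul_apply, pairing_ι_mul, hx,
      ctr_ι_mul]
    abel

lemma pairing_rho (w : V × Module.Dual K V) (x y : ExteriorAlgebra K (Module.Dual K V)) :
    pairing (rho w x) y = pairing x (rho w y) := by
  simp only [rho_apply, map_add, LinearMap.add_apply, pairing_ctr, pairing_ι_mul]

/-- Euler operator acts by the degree. -/
lemma euler {k : ℕ} {x : ExteriorAlgebra K (Module.Dual K V)}
    (hx : x ∈ ⋀[K]^k (Module.Dual K V)) :
    ∑ i, ExteriorAlgebra.ι K ((Module.finBasis K V).coord i) * ctr (Module.finBasis K V i) x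
      = (k : K) • x := by
  induction hx using Submodule.pow_induction_on_left' with
  | algebraMap r =>
    simp only [ctr_algebraMap, mul_zero, Finset.sum_const_zero, Nat.cast_zero, zero_smul]
  | add x y i hx hy h1 h2 =>
    simp only [map_add, mul_add, Finset.sum_add_distrib, h1, h2, smul_add]
  | mem_mul m hm k x hx ih =>
    obtain ⟨a, rfl⟩ := hm
    have h1 : ∀ i, ExteriorAlgebra.ι K ((Module.finBasis K V).coord i) *
        ctr (Module.finBasis K V i) (ExteriorAlgebra.ι K a * x) =
        ExteriorAlgebra.ι K (a (Module.finBasis K V i) • (Module.finBasis K V).coord i) * x +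
        ExteriorAlgebra.ι K a * (ExteriorAlgebra.ι K ((Module.finBasis K V).coord i) *
          ctr (Module.finBasis K V i) x) := by
      intro i
      have h2 := ι_mul_ι_mul ((Module.finBasis K V).coord i) a (ctr (Module.finBasis K V i) x)
      rw [ctr_ι_mul, mul_sub, eq_neg_of_add_eq_zero_left h2, map_smul, mul_smul_comm,
        smul_mul_assoc, sub_neg_eq_add]
    have h3 : ∑ i, a (Module.finBasis K V i) • (Module.finBasis K V).coord i = a :=
      Module.Basis.sum_dual_apply_smul_coord _ _
    rw [Finset.sum_congr rfl (fun i _ => h1 i), Finset.sum_add_distrib, ← Finset.mul_sum, ih,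
      ← Finset.sum_mul, ← map_sum, h3, mul_smul_comm, Nat.cast_succ, add_smul, one_smul, add_comm]

variable [CharZero K]

lemma scalar_of_ctr (x : ExteriorAlgebra K (Module.Dual K V)) (h : ∀ v, ctr v x = 0) :
    ∃ r : K, x = algebraMap K _ r := by
  have h1 : ∀ i, pr (i + 1) x = 0 := by
    intro i
    have h2 := euler (pr_mem (i + 1) x)
    simp only [← pr_ctr, h, map_zero, mul_zero, Finset.sum_const_zero] at h2
    rcases smul_eq_zero.1 h2.symm with h3 | h3
    · exact absurd h3 (Nat.cast_ne_zero.2 (Nat.succ_ne_zero i))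
    · exact h3
  have h2 : x = pr 0 x := by
    apply eq_of_pr
    intro i
    rw [pr_of_mem (pr_mem 0 x)]
    cases i with
    | zero => simp
    | succ i => simpa using h1 i
  have h3 := pr_mem 0 x
  rw [← h2] at h3
  unfold exteriorPower at h3
  rw [pow_zero] at h3
  obtain ⟨r, hr⟩ := Submodule.mem_one.1 h3
  exact ⟨r, hr.symm⟩

/-- Irreducibility of the spinor module. -/
lemma irreducible (W : Submodule K (ExteriorAlgebra K (Module.Dual K V)))
    (hW : ∀ w : V × Module.Dual K V, ∀ x ∈ W, rho w x ∈ W) (x) (hx : x ∈ W) (hx0 : x ≠ 0) :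
    ∀ y, y ∈ W := by
  have hc : ∀ v : V, ∀ x ∈ W, ctr v x ∈ W := by
    intro v x hx
    have := hW (v, 0) x hx
    simpa [rho_apply] using this
  have hm : ∀ a : Module.Dual K V, ∀ x ∈ W, ExteriorAlgebra.ι K a * x ∈ W := by
    intro v x hx
    have := hW (0, v) x hx
    have h0 : ctr (K := K) (0 : V) x = 0 := by
      unfold ctr
      rw [map_zero, map_zero, LinearMap.zero_apply]
    rw [rho_apply, h0, zero_add] at this
    exact this
  have h1 : ∀ k : ℕ, ∀ x ∈ W, x ≠ 0 → (∀ i, k ≤ i → pr i x = 0) → ∃ r : K, r ≠ 0 ∧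
      algebraMap K (ExteriorAlgebra K (Module.Dual K V)) r ∈ W := by
    intro k
    induction k with
    | zero =>
      intro x hx hx0 h
      exact absurd (eq_of_pr x 0 (fun i => by rw [h i (Nat.zero_le _), map_zero])) hx0
    | succ k ih =>
      intro x hx hx0 h
      by_cases hv : ∀ v, ctr v x = 0
      · obtain ⟨r, rfl⟩ := scalar_of_ctr x hv
        exact ⟨r, fun h => hx0 (by rw [h, map_zero]), hx⟩
      · push Not at hv
        obtain ⟨v, hv⟩ := hv
        refine ih _ (hc v x hx) hv (fun i hi => ?_)
        rw [pr_ctr, h _ (by omega), map_zero]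
  obtain ⟨r, hr, hrW⟩ := h1 (finrank K V + 1) x hx hx0
    (fun i hi => eq_zero_of_lt (by omega) (pr_mem i x))
  intro y
  induction y using CliffordAlgebra.left_induction with
  | algebraMap s =>
    have := W.smul_mem (s / r) hrW
    rw [Algebra.smul_def, ← map_mul, div_mul_cancel₀ _ hr] at this
    exact this
  | add x y hx hy => exact add_mem hx hy
  | ι_mul x a hx => exact hm a x hx

lemma pairing_nondeg (x : ExteriorAlgebra K (Module.Dual K V)) (h : ∀ y, pairing x y = 0) :
    x = 0 := by
  by_contra hx0
  have hall := irreducible (LinearMap.ker (pairing (K := K) (V := V))) (by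
    intro w x hx
    rw [LinearMap.mem_ker] at hx ⊢
    refine LinearMap.ext fun y => ?_
    rw [pairing_rho, hx, LinearMap.zero_apply, LinearMap.zero_apply]) x (by
    rw [LinearMap.mem_ker]
    exact LinearMap.ext h) hx0 1
  obtain ⟨y, hy⟩ := exists_top (K := K) (V := V)
  apply hy
  have h1 : pairing (1 : ExteriorAlgebra K (Module.Dual K V)) y = 0 := by
    rw [LinearMap.mem_ker.1 hall, LinearMap.zero_apply]
  have h2 : revE (1 : ExteriorAlgebra K (Module.Dual K V)) = 1 :=
    CliffordAlgebra.reverse.map_one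
  rwa [pairing_apply, h2, one_mul] at h1

end fin

/-- A linear functional on `V × V*` is pairing with a vector. -/
lemma exists_repr [FiniteDimensional K V] (f : Module.Dual K (V × Module.Dual K V)) :
    ∃ w : V × Module.Dual K V, ∀ u, f u = w.2 u.1 + u.2 w.1 := by
  obtain ⟨v, hv⟩ := (Module.evalEquiv K V).surjective (f.comp (LinearMap.inr K _ _))
  refine ⟨(v, f.comp (LinearMap.inl K _ _)), fun u => ?_⟩
  have h := LinearMap.congr_fun hv u.2
  rw [Module.evalEquiv_apply] at h
  simp only [Module.Dual.eval_apply, LinearMap.comp_apply, LinearMap.inr_apply] at h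
  rw [h]
  simp only [LinearMap.comp_apply, LinearMap.inl_apply]
  rw [← map_add]
  simp

end PureSpinorAux

open PureSpinorAux in

/-- Cartan/Chevalley: for pure spinors `φ, ψ ∈ ∧V*` defining Lagrangian
subspaces `E = N_φ` and `F = N_ψ`, the subspaces `E` and `F` are transverse if and only
if the top-degree component of `φᵀ ∧ ψ` is nonzero. -/
theorem pure_spinors_stmt17 {K V : Type*} [Field K] [CharZero K] [AddCommGroup V] [Module K V]
    [FiniteDimensional K V]
    (φ ψ : ExteriorAlgebra K (Module.Dual K V)) (hφ0 : φ ≠ 0) (hψ0 : ψ ≠ 0)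
    (E F : Set (V × Module.Dual K V))
    (hEφ : E = {w | cliffordRho w φ = 0})
    (hFψ : F = {w | cliffordRho w ψ = 0})
    (hElag : ∀ w, w ∈ E ↔ ∀ u ∈ E, w.2 u.1 + u.2 w.1 = 0)
    (hFlag : ∀ w, w ∈ F ↔ ∀ u ∈ F, w.2 u.1 + u.2 w.1 = 0) :
    (∀ w, w ∈ E → w ∈ F → w = 0) ↔
      GradedAlgebra.proj (fun i : ℕ => ⋀[K]^i (Module.Dual K V)) (Module.finrank K V)
        (revE φ * ψ) ≠ 0 := by
  have goal_eq : GradedAlgebra.proj (fun i : ℕ => ⋀[K]^i (Module.Dual K V)) (Module.finrank K V)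
        (revE φ * ψ) = pairing φ ψ := rfl
  rw [goal_eq]
  have hE : ∀ w, w ∈ E ↔ rho w φ = 0 := by
    intro w; rw [hEφ]; exact Iff.rfl
  have hF : ∀ w, w ∈ F ↔ rho w ψ = 0 := by
    intro w; rw [hFψ]; exact Iff.rfl
  constructor
  · intro htr h0
    -- E + F is everything
    let E' : Submodule K (V × Module.Dual K V) := LinearMap.ker ((rho (K := K) (V := V)).flip φ)
    let F' : Submodule K (V × Module.Dual K V) := LinearMap.ker ((rho (K := K) (V := V)).flip ψ)
    have hE' : ∀ w, w ∈ E' ↔ w ∈ E := by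
      intro w; rw [hE]; exact Iff.rfl
    have hF' : ∀ w, w ∈ F' ↔ w ∈ F := by
      intro w; rw [hF]; exact Iff.rfl
    have hsup : E' ⊔ F' = ⊤ := by
      by_contra hne
      obtain ⟨f, hf0, hf⟩ := Submodule.exists_le_ker_of_lt_top _ (lt_top_iff_ne_top.2 hne)
      obtain ⟨w, hw⟩ := exists_repr f
      have hwE : w ∈ E := by
        rw [hElag]
        intro u hu
        rw [← hw]
        exact hf (Submodule.mem_sup_left ((hE' u).2 hu))
      have hwF : w ∈ F := by
        rw [hFlag]
        intro u hu
        rw [← hw]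
        exact hf (Submodule.mem_sup_right ((hF' u).2 hu))
      have hw0 := htr w hwE hwF
      apply hf0
      ext u <;> simp [hw, hw0]
    -- the subspace generated from ψ by E
    let S : Set (Submodule K (ExteriorAlgebra K (Module.Dual K V))) :=
      {W | ψ ∈ W ∧ ∀ w ∈ E, ∀ x ∈ W, rho w x ∈ W}
    let W := sInf S
    have hψW : ψ ∈ W := Submodule.mem_sInf.2 fun U hU => hU.1
    have hEW : ∀ w ∈ E, ∀ x ∈ W, rho w x ∈ W := by
      intro w hw x hx
      exact Submodule.mem_sInf.2 fun U hU => hU.2 w hw x (Submodule.mem_sInf.1 hx U hU)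
    have hFW : ∀ f ∈ F, ∀ x ∈ W, rho f x ∈ W := by
      intro f hf x hx
      have hU : W ⊓ W.comap (rho f) ∈ S := by
        refine ⟨⟨hψW, ?_⟩, ?_⟩
        · change rho f ψ ∈ W
          rw [(hF f).1 hf]
          exact zero_mem _
        · rintro w hw x ⟨hx1, hx2⟩
          refine ⟨hEW w hw x hx1, ?_⟩
          change rho f (rho w x) ∈ W
          rw [eq_sub_of_add_eq (rho_anticomm f w x)]
          exact sub_mem (W.smul_mem _ hx1) (hEW w hw _ hx2)
      exact (Submodule.mem_sInf.1 hx _ hU).2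
    have hall : ∀ w : V × Module.Dual K V, ∀ x ∈ W, rho w x ∈ W := by
      intro w x hx
      have hw : w ∈ E' ⊔ F' := by rw [hsup]; trivial
      obtain ⟨e, he, f, hf, rfl⟩ := Submodule.mem_sup.1 hw
      rw [map_add, LinearMap.add_apply]
      exact add_mem (hEW e ((hE' e).1 he) x hx) (hFW f ((hF' f).1 hf) x hx)
    have htop := irreducible W hall ψ hψW hψ0
    apply hφ0
    apply pairing_nondeg
    intro y
    have hker : LinearMap.ker (pairing φ) ∈ S := by
      refine ⟨h0, fun w hw x _ => ?_⟩
      rw [LinearMap.mem_ker, ← pairing_rho, (hE w).1 hw, map_zero, LinearMap.zero_apply]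
    exact Submodule.mem_sInf.1 (htop y) _ hker
  · intro hne w hwE hwF
    by_contra hw0
    apply hne
    have hex : ∃ u : V × Module.Dual K V, w.2 u.1 + u.2 w.1 ≠ 0 := by
      by_contra hcon
      push Not at hcon
      apply hw0
      refine Prod.ext ?_ ?_
      · refine (Module.forall_dual_apply_eq_zero_iff K w.1).1 fun a => ?_
        simpa using hcon (0, a)
      · ext v
        simpa using hcon (v, 0)
    obtain ⟨u, hu⟩ := hex
    have h1 := rho_anticomm w u φ
    rw [(hE w).1 hwE, map_zero, add_zero] at h1
    have h2 : pairing (rho w (rho u φ)) ψ = 0 := by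
      rw [pairing_rho, (hF w).1 hwF, map_zero]
    rw [h1, map_smul, LinearMap.smul_apply] at h2
    exact (smul_eq_zero.1 h2).resolve_left hu
end
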